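/- arXiv:1707.04411 — 2 statements merged into one kernel-verified Lean document; each statement's English description precedes it below -/
import Mathlib

section
/- Let d ≥ 1 and let U = {u_1, …, u_k} be a finite set of non-zero vectors in ℤ^d that generate ℤ^d as a group. Then there exists a constant C (depending only on d and U) such that for all m, n ∈ ℕ with m ≥ 1, ∂*(n+m) − ∂*(n) ≤ C·m^{1−1/d}. -/
open Pointwise

/-- Edge boundary of a finite set `S ⊆ ℤ^d` in the Cayley graph generated by `u`. -/
def edgeBdry {d k : ℕ} (u : Fin k → (Fin d → ℤ)) (S : Finset (Fin d → ℤ)) : ℕ :=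
  ∑ i, (S.filter (fun v => v + u i ∉ S)).card

/-- `∂*(n)`: the minimum edge boundary over all finite `S ⊆ ℤ^d` with `|S| = n`. -/
noncomputable def edgeOpt {d k : ℕ} (u : Fin k → (Fin d → ℤ)) (n : ℕ) : ℕ :=
  sInf {m | ∃ S : Finset (Fin d → ℤ), S.card = n ∧ edgeBdry u S = m}

/-- The number of points of `S` that translation by `w` moves out of `S`. -/
def shiftBdry {G : Type*} [AddCommGroup G] [DecidableEq G] (S : Finset G) (w : G) : ℕ :=
  (S.filter (fun v => v + w ∉ S)).card

section ShiftBdry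

variable {G : Type*} [AddCommGroup G] [DecidableEq G]

lemma shiftBdry_zero (S : Finset G) : shiftBdry S 0 = 0 := by
  simp [shiftBdry]

lemma shiftBdry_add_le (S : Finset G) (a b : G) :
    shiftBdry S (a + b) ≤ shiftBdry S a + shiftBdry S b := by
  have hsub : S.filter (fun v => v + (a + b) ∉ S) ⊆
      S.filter (fun v => v + a ∉ S) ∪ (S.filter (fun v => v + b ∉ S)).image (fun v => v - a) := by
    intro v hv
    simp only [Finset.mem_filter, Finset.mem_union, Finset.mem_image] at hv ⊢
    by_cases h : v + a ∈ S
    · exact Or.inr ⟨v + a, ⟨h, by simpa [add_assoc] using hv.2⟩, by simp⟩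
    · exact Or.inl ⟨hv.1, h⟩
  calc shiftBdry S (a + b) ≤ _ := Finset.card_le_card hsub
    _ ≤ _ := Finset.card_union_le _ _
    _ ≤ _ := Nat.add_le_add_left Finset.card_image_le _

lemma shiftBdry_neg (S : Finset G) (a : G) : shiftBdry S (-a) = shiftBdry S a := by
  have h1 := Finset.card_filter_add_card_filter_not (s := S) (fun v => v + a ∈ S)
  have h2 := Finset.card_filter_add_card_filter_not (s := S) (fun v => v + -a ∈ S)
  have h3 : (S.filter (fun v => v + a ∈ S)).card = (S.filter (fun v => v + -a ∈ S)).card := by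
    refine Finset.card_bij' (fun v _ => v + a) (fun v _ => v + -a) ?_ ?_ ?_ ?_ <;>
      simp +contextual
  unfold shiftBdry
  omega

lemma shiftBdry_union_le (S T : Finset G) (w : G) :
    shiftBdry (S ∪ T) w ≤ shiftBdry S w + shiftBdry T w := by
  refine (Finset.card_le_card ?_).trans (Finset.card_union_le _ _)
  intro v hv
  simp only [Finset.mem_filter, Finset.mem_union, not_or] at hv ⊢
  tauto

lemma shiftBdry_map_addLeft (S : Finset G) (t w : G) :
    shiftBdry (S.map (addLeftEmbedding t)) w = shiftBdry S w := by
  simp only [shiftBdry, Finset.filter_map, Finset.card_map]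
  congr 1
  refine Finset.filter_congr fun v _ => ?_
  simp [add_assoc]

end ShiftBdry

lemma edgeBdry_eq_sum_shiftBdry {d k : ℕ} (u : Fin k → (Fin d → ℤ)) (S : Finset (Fin d → ℤ)) :
    edgeBdry u S = ∑ i, shiftBdry S (u i) := rfl

lemma edgeOpt_le {d k : ℕ} (u : Fin k → (Fin d → ℤ)) (S : Finset (Fin d → ℤ)) :
    edgeOpt u S.card ≤ edgeBdry u S :=
  Nat.sInf_le ⟨S, rfl, rfl⟩

lemma exists_edgeBdry_eq_edgeOpt {d k : ℕ} (hd : 1 ≤ d) (u : Fin k → (Fin d → ℤ)) (n : ℕ) :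
    ∃ S : Finset (Fin d → ℤ), S.card = n ∧ edgeBdry u S = edgeOpt u n := by
  have : Nonempty (Fin d) := ⟨⟨0, hd⟩⟩
  obtain ⟨S, hS⟩ := Infinite.exists_subset_card_eq (Fin d → ℤ) n
  exact Nat.sInf_mem (s := {m | ∃ S : Finset (Fin d → ℤ), S.card = n ∧ edgeBdry u S = m})
    ⟨_, S, hS, rfl⟩

lemma edgeOpt_add_le {d k : ℕ} (hd : 1 ≤ d) (u : Fin k → (Fin d → ℤ)) (n : ℕ)
    (B : Finset (Fin d → ℤ)) :
    edgeOpt u (n + B.card) ≤ edgeOpt u n + edgeBdry u B := by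
  have : Nonempty (Fin d) := ⟨⟨0, hd⟩⟩
  obtain ⟨S, rfl, hS⟩ := exists_edgeBdry_eq_edgeOpt hd u n
  obtain ⟨t, ht⟩ := Infinite.exists_notMem_finset (S - B)
  have hdisj : Disjoint S (B.map (addLeftEmbedding t)) := by
    rw [Finset.disjoint_left]
    intro x hxS hxB
    obtain ⟨b, hb, rfl⟩ := Finset.mem_map.mp hxB
    exact ht (Finset.mem_sub.mpr ⟨_, hxS, b, hb, by simp⟩)
  have h := edgeOpt_le u (S ∪ B.map (addLeftEmbedding t))
  rw [Finset.card_union_of_disjoint hdisj, Finset.card_map] at h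
  rw [← hS]
  refine h.trans ?_
  simp only [edgeBdry_eq_sum_shiftBdry, ← Finset.sum_add_distrib]
  refine Finset.sum_le_sum fun i _ => (shiftBdry_union_le _ _ _).trans ?_
  rw [shiftBdry_map_addLeft]

/-- `S` is a down-closed subset of the discrete cube `[0, L)^d`. -/
def IsCubeLowerSet {d : ℕ} (L : ℕ) (S : Finset (Fin d → ℤ)) : Prop :=
  S ⊆ Fintype.piFinset (fun _ => Finset.Ico (0 : ℤ) L) ∧
    ∀ v ∈ S, ∀ w, 0 ≤ w → w ≤ v → w ∈ S

lemma isCubeLowerSet_cube {d : ℕ} (L : ℕ) :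
    IsCubeLowerSet L (Fintype.piFinset (fun _ : Fin d => Finset.Ico (0 : ℤ) L)) := by
  refine ⟨subset_rfl, fun v hv w h0 hw => ?_⟩
  simp only [Fintype.mem_piFinset, Finset.mem_Ico] at hv ⊢
  exact fun i => ⟨h0 i, (hw i).trans_lt (hv i).2⟩

lemma IsCubeLowerSet.exists_card_eq {d L m : ℕ} {S : Finset (Fin d → ℤ)}
    (hS : IsCubeLowerSet L S) (hm : m ≤ S.card) :
    ∃ T : Finset (Fin d → ℤ), IsCubeLowerSet L T ∧ T.card = m := by
  induction hm using Nat.decreasingInduction with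
  | self => exact ⟨S, hS, rfl⟩
  | of_succ j _ ih =>
    obtain ⟨T, hT, hcard⟩ := ih
    obtain ⟨x, hx⟩ := T.exists_maximal (Finset.card_pos.mp (by omega))
    refine ⟨T.erase x, ⟨(Finset.erase_subset _ _).trans hT.1, fun v hv w h0 hw => ?_⟩, ?_⟩
    · rw [Finset.mem_erase] at hv ⊢
      refine ⟨?_, hT.2 v hv.2 w h0 hw⟩
      rintro rfl
      exact hv.1 (le_antisymm (hx.2 hv.2 hw) hw)
    · rw [Finset.card_erase_of_mem hx.1, hcard, Nat.add_sub_cancel]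

lemma IsCubeLowerSet.shiftBdry_single_le {d L : ℕ} {S : Finset (Fin d → ℤ)}
    (hS : IsCubeLowerSet L S) (i : Fin d) :
    shiftBdry S (Pi.single i 1) ≤ L ^ (d - 1) := by
  have hcard : (Fintype.piFinset
      (Function.update (fun _ : Fin d => Finset.Ico (0 : ℤ) L) i {0})).card = L ^ (d - 1) := by
    rw [Fintype.card_piFinset, ← Finset.mul_prod_erase _ _ (Finset.mem_univ i),
      Finset.prod_congr rfl (g := fun _ => L)]
    · simp
    · intro j hj
      simp [Function.update_of_ne (Finset.ne_of_mem_erase hj)]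
  have hle : ∀ v ∈ S, ∀ w, v + Pi.single i 1 ∉ S → w ∈ S →
      Function.update v i 0 = Function.update w i 0 → w i ≤ v i := by
    intro v hv w hv' hw heq
    by_contra! hlt
    refine hv' (hS.2 w hw _ (fun j => ?_) (fun j => ?_))
    · have h0 := (Finset.mem_Ico.mp (Fintype.mem_piFinset.mp (hS.1 hv) j)).1
      rcases eq_or_ne j i with rfl | hj
      · simp; omega
      · simpa [hj] using h0
    · rcases eq_or_ne j i with rfl | hj
      · simp; omega
      · have := congrFun heq j
        simp only [Function.update_of_ne hj] at this
        simp [hj, this]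
  rw [← hcard]
  refine Finset.card_le_card_of_injOn (fun v => Function.update v i 0) ?_ ?_
  · intro v hv
    have hvS := Fintype.mem_piFinset.mp (hS.1 (Finset.mem_filter.mp hv).1)
    simp only [Finset.mem_coe, Fintype.mem_piFinset]
    intro j
    rcases eq_or_ne j i with rfl | hj
    · simp
    · simpa [hj] using hvS j
  · intro v hv w hw heq
    have hv := Finset.mem_filter.mp hv
    have hw := Finset.mem_filter.mp hw
    have hi := le_antisymm (hle w hw.1 v hw.2 hv.1 heq.symm) (hle v hv.1 w hv.2 hw.1 heq)
    ext j
    rcases eq_or_ne j i with rfl | hj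
    · exact hi
    · simpa [hj] using congrFun heq j

/-- The vectors along which the boundary of down-closed subsets of `[0, L)^d` is
`O(L ^ (d - 1))`. -/
def cubeBdryBounded (d : ℕ) : AddSubgroup (Fin d → ℤ) where
  carrier := {w | ∃ C : ℕ, ∀ (L : ℕ) (S : Finset (Fin d → ℤ)), IsCubeLowerSet L S →
    shiftBdry S w ≤ C * L ^ (d - 1)}
  zero_mem' := ⟨0, fun L S _ => by simp [shiftBdry_zero]⟩
  add_mem' := by
    rintro a b ⟨C, hC⟩ ⟨D, hD⟩
    refine ⟨C + D, fun L S hS => (shiftBdry_add_le S a b).trans ?_⟩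
    rw [add_mul]
    exact Nat.add_le_add (hC L S hS) (hD L S hS)
  neg_mem' := by
    rintro a ⟨C, hC⟩
    exact ⟨C, fun L S hS => (shiftBdry_neg S a).trans_le (hC L S hS)⟩

lemma mem_cubeBdryBounded {d : ℕ} (w : Fin d → ℤ) : w ∈ cubeBdryBounded d := by
  have hw : w = ∑ i, w i • (Pi.single i 1 : Fin d → ℤ) := by
    ext j
    simp [Finset.sum_apply, Pi.single_apply]
  rw [hw]
  exact sum_mem fun i _ => zsmul_mem
    (show Pi.single i 1 ∈ cubeBdryBounded d from
      ⟨1, fun L S hS => by simpa using hS.shiftBdry_single_le i⟩) _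

lemma exists_card_eq_edgeBdry_le {d k : ℕ} (u : Fin k → (Fin d → ℤ)) :
    ∃ C : ℕ, ∀ L m : ℕ, m ≤ L ^ d →
      ∃ B : Finset (Fin d → ℤ), B.card = m ∧ edgeBdry u B ≤ C * L ^ (d - 1) := by
  choose C hC using fun i => mem_cubeBdryBounded (u i)
  refine ⟨∑ i, C i, fun L m hm => ?_⟩
  obtain ⟨B, hB, hcard⟩ := (isCubeLowerSet_cube (d := d) L).exists_card_eq (m := m) (by simpa)
  refine ⟨B, hcard, ?_⟩
  rw [edgeBdry_eq_sum_shiftBdry, Finset.sum_mul]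
  exact Finset.sum_le_sum fun i _ => hC i L B hB

lemma exists_le_pow_and_pow_pred_le {d m : ℕ} (hd : 1 ≤ d) (hm : 1 ≤ m) :
    ∃ L : ℕ, m ≤ L ^ d ∧
      (L : ℝ) ^ (d - 1) ≤ 2 ^ (d - 1) * (m : ℝ) ^ (1 - (1 : ℝ) / d) := by
  have hd0 : (d : ℝ) ≠ 0 := by positivity
  have hm1 : (1 : ℝ) ≤ m := by exact_mod_cast hm
  set r : ℝ := (m : ℝ) ^ ((1 : ℝ) / d) with hr
  have hr1 : 1 ≤ r := Real.one_le_rpow hm1 (by positivity)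
  refine ⟨⌈r⌉₊, ?_, ?_⟩
  · have hrd : r ^ d = m := by
      rw [hr, ← Real.rpow_natCast, ← Real.rpow_mul (by positivity), one_div,
        inv_mul_cancel₀ hd0, Real.rpow_one]
    have : (m : ℝ) ≤ (⌈r⌉₊ : ℝ) ^ d := hrd ▸ pow_le_pow_left₀ (by positivity) (Nat.le_ceil r) d
    exact_mod_cast this
  · have hrd : r ^ (d - 1) = (m : ℝ) ^ (1 - (1 : ℝ) / d) := by
      rw [hr, ← Real.rpow_natCast, ← Real.rpow_mul (by positivity), Nat.cast_sub hd]
      congr 1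
      field_simp
      simp
    rw [← hrd, ← mul_pow]
    refine pow_le_pow_left₀ (by positivity) ?_ _
    linarith [Nat.ceil_lt_add_one (zero_le_one.trans hr1)]

theorem edgeOpt_slowly_varying (d k : ℕ) (hd : 1 ≤ d)
    (u : Fin k → (Fin d → ℤ)) (hu : ∀ i, u i ≠ 0)
    (hgen : AddSubgroup.closure (Set.range u) = ⊤) :
    ∃ C : ℝ, ∀ m n : ℕ, 1 ≤ m →
      (edgeOpt u (n + m) : ℝ) - (edgeOpt u n : ℝ) ≤ C * (m : ℝ) ^ (1 - (1 : ℝ) / d) := by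
  obtain ⟨C, hC⟩ := exists_card_eq_edgeBdry_le u
  refine ⟨C * 2 ^ (d - 1), fun m n hm => ?_⟩
  obtain ⟨L, hmL, hL⟩ := exists_le_pow_and_pow_pred_le hd hm
  obtain ⟨B, rfl, hB⟩ := hC L m hmL
  have h : (edgeOpt u (n + B.card) : ℝ) ≤ edgeOpt u n + C * (L : ℝ) ^ (d - 1) := by
    exact_mod_cast (edgeOpt_add_le hd u n B).trans (Nat.add_le_add_left hB _)
  have h' := mul_le_mul_of_nonneg_left hL (Nat.cast_nonneg (α := ℝ) C)
  linarith
end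

section
/- Let d ≥ 1, let U = {u_1, …, u_k} be a finite set of non-zero vectors in ℤ^d, let Z_0 = {0,u_1} + ⋯ + {0,u_k} ⊆ ℤ^d, let Z be the convex hull of Z_0 in ℝ^d, and for t ∈ ℕ let Z(t) = (t·Z) ∩ ℤ^d. Then for each t ∈ ℕ, the edge boundary satisfies ∂(Z(t)) ≤ |Z(t+1)| − |Z(t)|. -/
open Pointwise

/-- Embedding of `ℤ^d` into `ℝ^d`. -/
def toReal' {d : ℕ} (v : Fin d → ℤ) : Fin d → ℝ := fun j => (v j : ℝ)

/-- The number of points of `S` that leave `S` under translation by `w`. -/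
def exitCard {d : ℕ} (w : Fin d → ℤ) (S : Finset (Fin d → ℤ)) : ℕ :=
  (S.filter (fun v => v + w ∉ S)).card

theorem card_add_exitCard_le {d : ℕ} {w : Fin d → ℤ} {A B : Finset (Fin d → ℤ)}
    (hAB : A ⊆ B) (h : ∀ v ∈ A, v + w ∈ B) : A.card + exitCard w A ≤ B.card := by
  have hinj : ((A.filter (fun v => v + w ∉ A)).image (fun v => v + w)).card = exitCard w A :=
    Finset.card_image_of_injective _ (add_left_injective w)
  rw [← hinj, ← Finset.card_union_of_disjoint]
  · apply Finset.card_le_card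
    intro x hx
    simp only [Finset.mem_union, Finset.mem_image, Finset.mem_filter] at hx
    rcases hx with hx | ⟨v, ⟨hv, -⟩, rfl⟩
    · exact hAB hx
    · exact h v hv
  · rw [Finset.disjoint_right]
    intro x hx
    simp only [Finset.mem_image, Finset.mem_filter] at hx
    obtain ⟨v, ⟨-, hv⟩, rfl⟩ := hx
    exact hv

theorem exists_add_nsmul_exit {d : ℕ} {w : Fin d → ℤ} (hw : w ≠ 0) {B : Finset (Fin d → ℤ)}
    {v : Fin d → ℤ} (hv : v ∈ B) : ∃ n : ℕ, v + n • w ∈ B ∧ v + n • w + w ∉ B := by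
  by_contra! hcon
  have hall : ∀ n : ℕ, v + n • w ∈ B := by
    intro n
    induction n with
    | zero => simpa using hv
    | succ n ih =>
      have := hcon n ih
      rwa [add_assoc, ← succ_nsmul] at this
  have hinj : Function.Injective (fun n : ℕ => v + n • w) := by
    intro m n hmn
    obtain ⟨j, hj⟩ := Function.ne_iff.mp hw
    have h := congrFun (add_left_cancel hmn) j
    simp only [Pi.smul_apply, nsmul_eq_mul] at h
    exact_mod_cast mul_right_cancel₀ hj h
  exact Set.infinite_of_injective_forall_mem hinj hall B.finite_toSet

/-- For sets without gaps in direction `w`, the number of exit points is at most that of any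
finite superset. -/
theorem exitCard_mono {d : ℕ} {w : Fin d → ℤ} (hw : w ≠ 0) {A B : Finset (Fin d → ℤ)}
    (hAB : A ⊆ B) (hA : ∀ v ∈ A, ∀ n : ℕ, v + (n + 1) • w ∈ A → v + w ∈ A) :
    exitCard w A ≤ exitCard w B := by
  choose! n hn using fun (v : Fin d → ℤ) (hv : v ∈ B) => exists_add_nsmul_exit hw hv
  have key : ∀ x ∈ A, x + w ∉ A → ∀ y ∈ A, x + n x • w = y + n y • w → n x ≤ n y := by
    intro x hx hxw y hy hxy
    by_contra! hlt
    obtain ⟨m, hm⟩ := Nat.exists_eq_add_of_lt hlt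
    apply hxw
    apply hA x hx m
    have : y = x + (m + 1) • w := by
      rw [hm, add_assoc, add_nsmul, add_comm (n y • w), ← add_assoc] at hxy
      exact (add_right_cancel hxy).symm
    rwa [← this]
  refine Finset.card_le_card_of_injOn (fun v => v + n v • w) ?_ ?_
  · intro v hv
    have hv' := (Finset.mem_filter.mp hv).1
    exact Finset.mem_filter.mpr (hn v (hAB hv'))
  · intro x hx y hy hxy
    obtain ⟨hx, hxw⟩ := Finset.mem_filter.mp hx
    obtain ⟨hy, hyw⟩ := Finset.mem_filter.mp hy
    have h := le_antisymm (key x hx hxw y hy hxy) (key y hy hyw x hx hxy.symm)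
    simp only [h] at hxy
    exact add_right_cancel hxy

/-- `toReal'` as an additive homomorphism. -/
def toRealHom (d : ℕ) : (Fin d → ℤ) →+ (Fin d → ℝ) where
  toFun := toReal'
  map_zero' := by ext; simp [toReal']
  map_add' x y := by ext; simp [toReal']

theorem toReal'_add {d : ℕ} (v w : Fin d → ℤ) : toReal' (v + w) = toReal' v + toReal' w :=
  map_add (toRealHom d) v w

theorem Convex.toReal'_add_mem {d : ℕ} {P : Set (Fin d → ℝ)} (hP : Convex ℝ P)
    {v w : Fin d → ℤ} {n : ℕ} (hv : toReal' v ∈ P) (hn : toReal' (v + (n + 1) • w) ∈ P) :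
    toReal' (v + w) ∈ P := by
  have hpos : (0 : ℝ) < n + 1 := by positivity
  have h := hP.add_smul_sub_mem hv hn (t := 1 / ((n : ℝ) + 1))
    ⟨by positivity, by rw [div_le_one hpos]; linarith [(Nat.cast_nonneg n : (0 : ℝ) ≤ n)]⟩
  convert h using 1
  ext j
  simp only [toReal', Pi.add_apply, Pi.smul_apply, Pi.sub_apply, smul_eq_mul, nsmul_eq_mul]
  push_cast
  simp
  field_simp

theorem convexHull_image_sum_pairs {d k : ℕ} (u : Fin k → (Fin d → ℤ)) :
    convexHull ℝ (toReal' '' ((∑ i, ({0, u i} : Finset (Fin d → ℤ)) : Finset (Fin d → ℤ)) :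
      Set (Fin d → ℤ))) = ∑ i, convexHull ℝ {0, toReal' (u i)} := by
  rw [← convexHull_sum, Finset.coe_sum]
  congr 1
  change toRealHom d '' _ = _
  rw [Set.image_finsetSum]
  refine Finset.sum_congr rfl fun i _ => ?_
  rw [Finset.coe_pair, Set.image_pair, map_zero]
  rfl

theorem zonotope_edge_boundary_telescopes (d k : ℕ) (hd : 1 ≤ d)
    (u : Fin k → (Fin d → ℤ)) (hu : ∀ i, u i ≠ 0)
    (Z0 : Finset (Fin d → ℤ))
    (hZ0 : Z0 = ∑ i, ({0, u i} : Finset (Fin d → ℤ)))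
    (Z : Set (Fin d → ℝ))
    (hZ : Z = convexHull ℝ (toReal' '' (Z0 : Set (Fin d → ℤ))))
    (t : ℕ)
    (Zt : Finset (Fin d → ℤ)) (hZt : ∀ v, v ∈ Zt ↔ toReal' v ∈ (t : ℝ) • Z)
    (Zt1 : Finset (Fin d → ℤ)) (hZt1 : ∀ v, v ∈ Zt1 ↔ toReal' v ∈ ((t : ℝ) + 1) • Z) :
    (edgeBdry u Zt : ℤ) ≤ (Zt1.card : ℤ) - (Zt.card : ℤ) := by
  classical
  have hZc : Convex ℝ Z := hZ ▸ convex_convexHull ℝ _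
  have hZsum : Z = ∑ i, convexHull ℝ {0, toReal' (u i)} := by
    rw [hZ, hZ0, convexHull_image_sum_pairs]
  let P : Finset (Fin k) → Set (Fin d → ℝ) := fun s =>
    (t : ℝ) • Z + ∑ i ∈ s, convexHull ℝ {0, toReal' (u i)}
  have hPuniv : P Finset.univ = ((t : ℝ) + 1) • Z := by
    rw [hZc.add_smul (Nat.cast_nonneg t) zero_le_one, one_smul]
    simp only [P, ← hZsum]
  have hzero : ∀ s : Finset (Fin k),
      (0 : Fin d → ℝ) ∈ ∑ i ∈ s, convexHull ℝ {0, toReal' (u i)} := by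
    intro s
    rw [Set.mem_finsetSum]
    exact ⟨fun _ => 0, fun _ => subset_convexHull ℝ _ (Set.mem_insert _ _), by simp⟩
  have hPmono : ∀ s r : Finset (Fin k), s ⊆ r → P s ⊆ P r := by
    intro s r hsr
    simp only [P]
    rw [← Finset.sum_sdiff hsr]
    exact Set.add_subset_add_left (Set.subset_add_right _ (hzero _))
  have hPins : ∀ (s : Finset (Fin k)) (i : Fin k), i ∉ s → ∀ v, toReal' v ∈ P s →
      toReal' (v + u i) ∈ P (insert i s) := by
    intro s i hi v hv
    simp only [P]
    rw [Finset.sum_insert hi, add_left_comm, toReal'_add, add_comm (convexHull ℝ _)]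
    exact Set.add_mem_add hv (subset_convexHull ℝ _ (Set.mem_insert_of_mem _ rfl))
  let S : Finset (Fin k) → Finset (Fin d → ℤ) := fun s => Zt1.filter (fun v => toReal' v ∈ P s)
  have hS : ∀ s v, v ∈ S s ↔ toReal' v ∈ P s := by
    intro s v
    simp only [S, Finset.mem_filter, hZt1, ← hPuniv, and_iff_right_iff_imp]
    exact fun h => hPmono _ _ (Finset.subset_univ s) h
  have hS0 : S ∅ = Zt := by
    ext v
    simp [hS, hZt, P]
  have hS1 : S Finset.univ = Zt1 := by
    ext v
    rw [hS, hPuniv, hZt1]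
  have main : ∀ s : Finset (Fin k), Zt.card + ∑ i ∈ s, exitCard (u i) Zt ≤ (S s).card := by
    intro s
    induction s using Finset.induction_on with
    | empty => simp [hS0]
    | insert i s hi ih =>
      have hstep : (S s).card + exitCard (u i) (S s) ≤ (S (insert i s)).card :=
        card_add_exitCard_le
          (fun v hv => (hS _ v).2 (hPmono _ _ (Finset.subset_insert i s) ((hS _ v).1 hv)))
          (fun v hv => (hS _ _).2 (hPins s i hi v ((hS _ v).1 hv)))
      have hexit : exitCard (u i) Zt ≤ exitCard (u i) (S s) := by
        refine exitCard_mono (hu i) ?_ ?_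
        · rw [← hS0]
          exact fun v hv => (hS _ v).2 (hPmono _ _ (Finset.empty_subset s) ((hS _ v).1 hv))
        · intro v hv n hn
          rw [hZt] at hv hn ⊢
          exact (hZc.smul (t : ℝ)).toReal'_add_mem hv hn
      rw [Finset.sum_insert hi]
      omega
  have hfinal := main Finset.univ
  rw [hS1] at hfinal
  have hedge : edgeBdry u Zt = ∑ i, exitCard (u i) Zt := rfl
  omega
end
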